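/- Let Ω ⊆ ℝⁿ be open and let u : Ω → ℝ be a C² solution of the graphic translator equation on Ω. Set v = √(1+|∇u|²), let g(x) be the n×n matrix with entries g_{ij} = δ_{ij} + ∂_i u·∂_j u, g^{ij} the entries of g⁻¹, H(x) the Hessian matrix of u at x, and |B|²(x) = tr((g(x)⁻¹ H(x))²)/v(x)². Then for every smooth compactly supported function φ : Ω → ℝ one has ∫_Ω ( Σ_{i,j} g^{ij} ∂_iφ ∂_jφ − |B|² φ² ) e^{u} v dx ≥ 0. -/

import Mathlib

open MeasureTheory

theorem gts_inv {n : ℕ} (p : Fin n → ℝ) (v : ℝ) (hv : v ^ 2 = 1 + ∑ i, p i ^ 2) (hv0 : 0 < v)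
    (g : Matrix (Fin n) (Fin n) ℝ)
    (hg : ∀ i j, g i j = (if i = j then (1 : ℝ) else 0) + p i * p j) :
    ∀ i j, g⁻¹ i j = (if i = j then (1 : ℝ) else 0) - p i * p j / v ^ 2 := by
  have hinv : g⁻¹ = Matrix.of (fun i j => (if i = j then (1 : ℝ) else 0) - p i * p j / v ^ 2) := by
    apply Matrix.inv_eq_right_inv
    ext i j
    simp only [Matrix.mul_apply, Matrix.of_apply, hg, Matrix.one_apply]
    have h1 : ∀ k, ((if i = k then (1 : ℝ) else 0) + p i * p k) *
        ((if k = j then (1 : ℝ) else 0) - p k * p j / v ^ 2)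
        = (if i = k then ((if k = j then (1 : ℝ) else 0) - p k * p j / v ^ 2) else 0)
          + ((if k = j then p i * p k else 0) - p k ^ 2 * (p i * p j / v ^ 2)) := by
      intro k
      split_ifs <;> ring
    simp only [h1, Finset.sum_add_distrib, Finset.sum_sub_distrib, Finset.sum_ite_eq,
      Finset.sum_ite_eq', Finset.mem_univ, if_true, ← Finset.sum_mul]
    have h2 : ∑ k, p k ^ 2 = v ^ 2 - 1 := by linarith
    rw [h2]
    field_simp
    ring
  intro i j
  rw [hinv]; rfl

theorem gts_alg {n : ℕ} (p q : Fin n → ℝ) (H : Matrix (Fin n) (Fin n) ℝ)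
    (hs : ∀ i j, H i j = H j i) (v f e : ℝ) (hv : v ^ 2 = 1 + ∑ i, p i ^ 2) (hv0 : 0 < v)
    (g : Matrix (Fin n) (Fin n) ℝ)
    (hg : ∀ i j, g i j = (if i = j then (1 : ℝ) else 0) + p i * p j)
    (a : Fin n → ℝ) (ha : ∀ k, a k = ∑ j, H k j * p j) :
    ((∑ i, ∑ j, g⁻¹ i j * q i * q j)
      - Matrix.trace ((g⁻¹ * H) * (g⁻¹ * H)) / v ^ 2 * f ^ 2) * (e * v)
    = e / v * (∑ i, (v * q i + f * a i / v) ^ 2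
          - (∑ i, p i * (v * q i + f * a i / v)) ^ 2 / v ^ 2)
      - (∑ i, ∑ k, (H k i / v - p i * a k / v ^ 3)
          * (e * (2 * f * q i * p k + f ^ 2 * p i * p k + f ^ 2 * H i k)))
      + ∑ k, (a k / v ^ 3) * (f ^ 2 * e * p k) := by
  have hG := gts_inv p v hv hv0 g hg
  set pp := ∑ i, p i ^ 2 with hpp
  have e1 : ∑ i, ∑ j, g⁻¹ i j * q i * q j
      = ∑ i, q i ^ 2 - (∑ i, p i * q i) ^ 2 / v ^ 2 := by
    have : ∀ i j, g⁻¹ i j * q i * q j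
        = (if i = j then q i * q j else 0) - (p i * q i) * (p j * q j) / v ^ 2 := by
      intro i j; rw [hG]; split_ifs <;> ring
    simp only [this, Finset.sum_sub_distrib, Finset.sum_ite_eq, Finset.mem_univ, if_true,
      ← Finset.sum_div, ← Finset.mul_sum, ← Finset.sum_mul]
    simp only [pow_two]
  have hGH : ∀ i j, (g⁻¹ * H) i j = H i j - p i * a j / v ^ 2 := by
    intro i j
    rw [Matrix.mul_apply]
    have : ∀ k, g⁻¹ i k * H k j = (if i = k then H k j else 0) - p i * (H j k * p k) / v ^ 2 := by
      intro k; rw [hG, hs j k]; split_ifs <;> ring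
    simp only [this, Finset.sum_sub_distrib, Finset.sum_ite_eq, Finset.mem_univ, if_true,
      ← Finset.sum_div, ← Finset.mul_sum, ← ha]
  have haa : ∑ i, ∑ j, H i j * p j * a i = ∑ i, a i ^ 2 := by
    refine Finset.sum_congr rfl fun i _ => ?_
    rw [← Finset.sum_mul, ← ha, pow_two]
  have haa' : ∑ i, ∑ j, H i j * p i * a j = ∑ i, a i ^ 2 := by
    rw [Finset.sum_comm, ← haa]
    refine Finset.sum_congr rfl fun i _ => Finset.sum_congr rfl fun j _ => ?_
    rw [hs]
  have haa2 : ∑ i, a i * a i = ∑ i, a i ^ 2 := by simp only [pow_two]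
  have hpa : ∑ i, a i * p i = ∑ i, p i * a i := by simp only [mul_comm]
  have e2 : Matrix.trace ((g⁻¹ * H) * (g⁻¹ * H))
      = ∑ i, ∑ j, H i j ^ 2 - 2 * (∑ i, a i ^ 2) / v ^ 2 + (∑ i, p i * a i) ^ 2 / v ^ 4 := by
    simp only [Matrix.trace, Matrix.diag, Matrix.mul_apply (M := g⁻¹ * H), hGH]
    have : ∀ i j, (H i j - p i * a j / v ^ 2) * (H j i - p j * a i / v ^ 2)
        = H i j ^ 2 - (H i j * p j * a i) / v ^ 2 - (H i j * p i * a j) / v ^ 2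
          + (p i * a i) * (p j * a j) / v ^ 4 := by
      intro i j; rw [hs j i]; field_simp; ring
    simp only [this, Finset.sum_sub_distrib, Finset.sum_add_distrib, ← Finset.sum_div,
      ← Finset.mul_sum, ← Finset.sum_mul, haa', ← ha, haa2]
    ring
  have e3 : ∑ i, (v * q i + f * a i / v) ^ 2
      = v ^ 2 * ∑ i, q i ^ 2 + 2 * f * ∑ i, a i * q i + f ^ 2 / v ^ 2 * ∑ i, a i ^ 2 := by
    simp only [Finset.mul_sum, ← Finset.sum_add_distrib]
    refine Finset.sum_congr rfl fun i _ => ?_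
    field_simp; ring
  have e4 : ∑ i, p i * (v * q i + f * a i / v)
      = v * ∑ i, p i * q i + f / v * ∑ i, p i * a i := by
    simp only [Finset.mul_sum, ← Finset.sum_add_distrib]
    refine Finset.sum_congr rfl fun i _ => ?_
    field_simp
  have e6 : ∑ k, (a k / v ^ 3) * (f ^ 2 * e * p k) = f ^ 2 * e / v ^ 3 * ∑ i, p i * a i := by
    simp only [Finset.mul_sum]
    refine Finset.sum_congr rfl fun i _ => ?_
    field_simp
  have e5 : ∑ i, ∑ k, (H k i / v - p i * a k / v ^ 3)
          * (e * (2 * f * q i * p k + f ^ 2 * p i * p k + f ^ 2 * H i k))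
      = e * ((2 * f * ∑ i, a i * q i + f ^ 2 * ∑ i, p i * a i + f ^ 2 * ∑ i, ∑ j, H i j ^ 2) / v
        - (2 * f * (∑ i, p i * q i) * (∑ i, p i * a i) + f ^ 2 * pp * (∑ i, p i * a i)
          + f ^ 2 * ∑ i, a i ^ 2) / v ^ 3) := by
    have : ∀ i k, (H k i / v - p i * a k / v ^ 3)
          * (e * (2 * f * q i * p k + f ^ 2 * p i * p k + f ^ 2 * H i k))
        = (2 * f * e / v) * (H i k * p k * q i) + (f ^ 2 * e / v) * (H i k * p k * p i)
          + (f ^ 2 * e / v) * H i k ^ 2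
          - (2 * f * e / v ^ 3) * ((p i * q i) * (p k * a k))
          - (f ^ 2 * e / v ^ 3) * (p i ^ 2 * (p k * a k))
          - (f ^ 2 * e / v ^ 3) * (H i k * p i * a k) := by
      intro i k; rw [hs k i]; field_simp; ring
    simp only [this, Finset.sum_sub_distrib, Finset.sum_add_distrib, 
      ← Finset.mul_sum, ← Finset.sum_mul, haa', ← ha, hpa]
    rw [← hpp]
    field_simp; ring
  rw [e1, e2, e3, e4, e5, e6]
  have h2 : pp = v ^ 2 - 1 := by linarith
  rw [h2]
  field_simp
  ring

theorem gts_nonneg {n : ℕ} (p x : Fin n → ℝ) (v : ℝ) (hv : v ^ 2 = 1 + ∑ i, p i ^ 2)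
    (hv0 : 0 < v) : 0 ≤ ∑ i, x i ^ 2 - (∑ i, p i * x i) ^ 2 / v ^ 2 := by
  have h := Finset.sum_mul_sq_le_sq_mul_sq Finset.univ p x
  have hx : 0 ≤ ∑ i, x i ^ 2 := Finset.sum_nonneg fun i _ => sq_nonneg _
  rw [sub_nonneg, div_le_iff₀ (by positivity), hv]
  nlinarith

theorem gts_swap {n : ℕ} (T η : (Fin n → ℝ) → ℝ) (hT : ContDiff ℝ 1 T) (hη : ContDiff ℝ 1 η)
    (hTc : HasCompactSupport T) (hηc : HasCompactSupport η) (d w : Fin n → ℝ) :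
    ∫ x, fderiv ℝ T x d * fderiv ℝ η x w = ∫ x, fderiv ℝ T x w * fderiv ℝ η x d := by
  have cT : ∀ d, Continuous (fun x => fderiv ℝ T x d) := fun d =>
    (hT.continuous_fderiv one_ne_zero).clm_apply continuous_const
  have cη : ∀ d, Continuous (fun x => fderiv ℝ η x d) := fun d =>
    (hη.continuous_fderiv one_ne_zero).clm_apply continuous_const
  have kη : ∀ d, HasCompactSupport (fun x => fderiv ℝ η x d) := fun d =>
    hηc.fderiv_apply ℝ d
  have kT : ∀ d, HasCompactSupport (fun x => fderiv ℝ T x d) := fun d =>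
    hTc.fderiv_apply ℝ d
  obtain ⟨C, hC⟩ := ContDiff.lipschitzWith_of_hasCompactSupport hTc hT one_ne_zero
  obtain ⟨C', hC'⟩ := ContDiff.lipschitzWith_of_hasCompactSupport hηc hη one_ne_zero
  have A := hC.integral_inv_smul_sub_mul_tendsto_integral_lineDeriv_mul (μ := volume)
    ((cη w).integrable_of_hasCompactSupport (kη w)) d
  have B := hC'.integral_inv_smul_sub_mul_tendsto_integral_lineDeriv_mul (μ := volume)
    ((cT w).integrable_of_hasCompactSupport (kT w)) (-d)
  have dT : Differentiable ℝ T := hT.differentiable one_ne_zero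
  have dη : Differentiable ℝ η := hη.differentiable one_ne_zero
  have key : ∀ t : ℝ, ∫ x, (t⁻¹ • (T (x + t • d) - T x)) * fderiv ℝ η x w
      = - ∫ x, (t⁻¹ • (η (x + t • (-d)) - η x)) * fderiv ℝ T x w := by
    intro t
    have ds : Differentiable ℝ (fun x => T (x + t • d)) := by fun_prop
    have fs : ∀ x, fderiv ℝ (fun x => T (x + t • d)) x w = fderiv ℝ T (x + t • d) w := by
      intro x; rw [fderiv_comp_add_right]
    have cs : Continuous (fun x => fderiv ℝ T (x + t • d) w) :=
      (cT w).comp (continuous_id.add continuous_const)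
    have i1 : ∫ x, T (x + t • d) * fderiv ℝ η x w = - ∫ x, fderiv ℝ T (x + t • d) w * η x := by
      rw [integral_mul_fderiv_eq_neg_fderiv_mul_of_integrable (f := fun x => T (x + t • d))]
      · simp only [fs]
      · simp only [fs]
        exact (cs.mul hη.continuous).integrable_of_hasCompactSupport hηc.mul_left
      · exact (ds.continuous.mul (cη w)).integrable_of_hasCompactSupport (kη w).mul_left
      · exact (ds.continuous.mul hη.continuous).integrable_of_hasCompactSupport hηc.mul_left
      · exact fun x _ => ds x
      · exact fun x _ => dη x
    have i2 : ∫ x, T x * fderiv ℝ η x w = - ∫ x, fderiv ℝ T x w * η x := by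
      rw [integral_mul_fderiv_eq_neg_fderiv_mul_of_integrable]
      · exact ((cT w).mul hη.continuous).integrable_of_hasCompactSupport hηc.mul_left
      · exact (dT.continuous.mul (cη w)).integrable_of_hasCompactSupport (kη w).mul_left
      · exact (dT.continuous.mul hη.continuous).integrable_of_hasCompactSupport hηc.mul_left
      · exact fun x _ => dT x
      · exact fun x _ => dη x
    have i3 : ∫ x, fderiv ℝ T (x + t • d) w * η x
        = ∫ x, fderiv ℝ T x w * η (x + t • (-d)) := by
      rw [← integral_add_right_eq_self _ (t • (-d))]; simp
    have j1 : ∫ x, (T (x + t • d) - T x) * fderiv ℝ η x w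
        = (∫ x, T (x + t • d) * fderiv ℝ η x w) - ∫ x, T x * fderiv ℝ η x w := by
      rw [← integral_sub]
      · simp only [sub_mul]
      · exact (ds.continuous.mul (cη w)).integrable_of_hasCompactSupport (kη w).mul_left
      · exact (dT.continuous.mul (cη w)).integrable_of_hasCompactSupport (kη w).mul_left
    have j2 : ∫ x, (η (x + t • (-d)) - η x) * fderiv ℝ T x w
        = (∫ x, fderiv ℝ T x w * η (x + t • (-d))) - ∫ x, fderiv ℝ T x w * η x := by
      rw [← integral_sub]
      · congr 1; ext x; ring
      · refine ((cT w).mul (hη.continuous.comp (continuous_id.add continuous_const))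
          ).integrable_of_hasCompactSupport (kT w).mul_right
      · exact ((cT w).mul hη.continuous).integrable_of_hasCompactSupport hηc.mul_left
    simp only [smul_eq_mul, mul_assoc, integral_const_mul]
    rw [j1, j2, i1, i2, i3]
    ring
  simp only [key] at A
  have U := tendsto_nhds_unique A B.neg
  have l1 : ∀ x, lineDeriv ℝ T x d = fderiv ℝ T x d := fun x => (dT x).lineDeriv_eq_fderiv
  have l2 : ∀ x, lineDeriv ℝ η x (-d) = - fderiv ℝ η x d := fun x => by
    rw [(dη x).lineDeriv_eq_fderiv, map_neg]
  simp only [l1, l2, neg_mul, integral_neg, neg_neg] at U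
  rw [U]
  simp only [mul_comm]

theorem gts_line {n : ℕ} {f : (Fin n → ℝ) → ℝ} (hf : Differentiable ℝ f) (x w : Fin n → ℝ) :
    HasDerivAt (fun t : ℝ => f (x + t • w)) (fderiv ℝ f x w) 0 :=
  (hf x).hasFDerivAt.hasLineDerivAt w

theorem gts_core
    (n : ℕ) (u : (Fin n → ℝ) → ℝ) (hu : ContDiff ℝ 2 u) (huc : HasCompactSupport u)
    (v : (Fin n → ℝ) → ℝ)
    (hv : ∀ x, v x = Real.sqrt (1 + ∑ i, (fderiv ℝ u x (Pi.single i 1)) ^ 2))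
    (g : (Fin n → ℝ) → Matrix (Fin n) (Fin n) ℝ)
    (hg : ∀ x i j, g x i j = (if i = j then (1 : ℝ) else 0)
        + fderiv ℝ u x (Pi.single i 1) * fderiv ℝ u x (Pi.single j 1))
    (H : (Fin n → ℝ) → Matrix (Fin n) (Fin n) ℝ)
    (hH : ∀ x i j, H x i j
        = fderiv ℝ (fun y => fderiv ℝ u y (Pi.single j 1)) x (Pi.single i 1))
    (Bsq : (Fin n → ℝ) → ℝ)
    (hB : ∀ x, Bsq x = Matrix.trace (((g x)⁻¹ * H x) * ((g x)⁻¹ * H x)) / (v x) ^ 2)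
    (φ : (Fin n → ℝ) → ℝ) (hφ : ContDiff ℝ 1 φ)
    (hφc : HasCompactSupport φ)
    (heq : ∀ x ∈ tsupport φ,
      ∑ i, fderiv ℝ (fun y => fderiv ℝ u y (Pi.single i 1) / v y) x (Pi.single i 1)
        = 1 / v x) :
    0 ≤ ∫ x,
        ((∑ i, ∑ j, (g x)⁻¹ i j * fderiv ℝ φ x (Pi.single i 1) * fderiv ℝ φ x (Pi.single j 1))
            - Bsq x * (φ x) ^ 2) * (Real.exp (u x) * v x) := by
  obtain ⟨E, hE⟩ : ∃ E : Fin n → (Fin n → ℝ), E = fun i => Pi.single i 1 := ⟨_, rfl⟩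
  have hE' : ∀ i, (Pi.single i 1 : Fin n → ℝ) = E i := fun i => by rw [hE]
  simp only [hE'] at *
  clear hE hE'
  obtain ⟨p, hp⟩ : ∃ p : Fin n → (Fin n → ℝ) → ℝ, p = fun i x => fderiv ℝ u x (E i) := ⟨_, rfl⟩
  have hp' : ∀ i x, fderiv ℝ u x (E i) = p i x := fun i x => by rw [hp]
  have cp : ∀ i, ContDiff ℝ 1 (p i) := by
    intro i; rw [hp]
    exact (hu.fderiv_right (m := 1) (by norm_num)).clm_apply contDiff_const
  have kp : ∀ i, HasCompactSupport (p i) := by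
    intro i; rw [hp]
    exact huc.fderiv_apply ℝ (E i)
  have hs : ∀ x i j, H x i j = H x j i := by
    intro x i j
    have hd : Differentiable ℝ (fderiv ℝ u) :=
      (hu.fderiv_right (m := 1) (by norm_num)).differentiable one_ne_zero
    have h2 : ∀ w z, fderiv ℝ (fun y => fderiv ℝ u y w) x z = fderiv ℝ (fderiv ℝ u) x z w := by
      intro w z
      rw [fderiv_clm_apply (hd x) (differentiableAt_const w)]
      simp
    rw [hH, hH, h2, h2]
    exact (hu.contDiffAt.isSymmSndFDerivAt (by simp)).eq _ _
  simp only [hp'] at hv hg hH heq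
  have dp : ∀ i, Differentiable ℝ (p i) := fun i => (cp i).differentiable one_ne_zero
  have cu : ContDiff ℝ 1 u := hu.of_le (by norm_num)
  have du : Differentiable ℝ u := cu.differentiable one_ne_zero
  have dφ : Differentiable ℝ φ := hφ.differentiable one_ne_zero
  have hS : ∀ x, 0 < 1 + ∑ i, p i x ^ 2 := fun x => by positivity
  have hv0 : ∀ x, 0 < v x := fun x => by rw [hv]; exact Real.sqrt_pos.2 (hS x)
  have hv2 : ∀ x, v x ^ 2 = 1 + ∑ i, p i x ^ 2 := fun x => by
    rw [hv]; exact Real.sq_sqrt (hS x).le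
  have cv : ContDiff ℝ 1 v := by
    have : v = fun x => Real.sqrt (1 + ∑ i, p i x ^ 2) := funext hv
    rw [this]
    exact (contDiff_const.add (ContDiff.sum fun i _ => (cp i).pow 2)).sqrt fun x => (hS x).ne'
  have dv : Differentiable ℝ v := cv.differentiable one_ne_zero
  obtain ⟨a, ha⟩ : ∃ a : (Fin n → ℝ) → Fin n → ℝ, ∀ x k, a x k = ∑ j, H x k j * p j x :=
    ⟨fun x k => ∑ j, H x k j * p j x, fun _ _ => rfl⟩
  have fv : ∀ x k, fderiv ℝ v x (E k) = a x k / v x := by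
    intro x k
    have h1 := gts_line dv x (E k)
    have h2 : HasDerivAt (fun t : ℝ => v (x + t • E k) ^ 2) (2 * a x k) 0 := by
      simp only [hv2]
      have h3 : HasDerivAt (fun t : ℝ => ∑ i, p i (x + t • E k) ^ 2)
          (∑ i, 2 * p i x * fderiv ℝ (p i) x (E k)) 0 := by
        apply HasDerivAt.fun_sum
        intro i _
        have := (gts_line (dp i) x (E k)).fun_pow 2
        simpa using this
      have h4 := h3.const_add 1
      have h6 : 2 * a x k = ∑ i, 2 * p i x * fderiv ℝ (p i) x (E k) := by
        rw [ha, Finset.mul_sum]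
        refine Finset.sum_congr rfl fun j _ => ?_
        rw [hH]; ring
      rw [h6]
      exact h4
    have h5 := (h1.fun_pow 2).unique h2
    simp at h5
    have := hv0 x
    field_simp
    linarith
  -- the vector field T
  obtain ⟨T, hT⟩ : ∃ T : Fin n → (Fin n → ℝ) → ℝ, T = fun i y => p i y / v y := ⟨_, rfl⟩
  have hT' : ∀ i, (fun y => p i y / v y) = T i := fun i => by rw [hT]
  simp only [hT'] at *
  have cT : ∀ i, ContDiff ℝ 1 (T i) := fun i => by
    rw [hT]; exact (cp i).div cv fun x => (hv0 x).ne'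
  have kT : ∀ i, HasCompactSupport (T i) := fun i => by
    rw [hT]; simp only [div_eq_mul_inv]; exact (kp i).mul_right
  have dT : ∀ i, Differentiable ℝ (T i) := fun i => (cT i).differentiable one_ne_zero
  have fT : ∀ x i k, fderiv ℝ (T i) x (E k) = H x k i / v x - p i x * a x k / v x ^ 3 := by
    intro x i k
    have h1 := (gts_line (dp i) x (E k)).fun_div (gts_line dv x (E k)) (by simpa using (hv0 x).ne')
    have h2 := gts_line (dT i) x (E k)
    simp only [hT] at h2
    have h3 := h2.unique h1
    simp only [hT]
    rw [h3, fv, ← hH]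
    have := hv0 x
    simp
    field_simp
  -- the test field η
  obtain ⟨η, hη⟩ : ∃ η : Fin n → (Fin n → ℝ) → ℝ,
    η = fun k y => φ y ^ 2 * Real.exp (u y) * p k y := ⟨_, rfl⟩
  have cη : ∀ i, ContDiff ℝ 1 (η i) := fun i => by
    rw [hη]; exact ((hφ.pow 2).mul cu.exp).mul (cp i)
  have η0 : ∀ k x, x ∉ tsupport φ → η k x = 0 := by
    intro k x hx
    simp [hη, image_eq_zero_of_notMem_tsupport hx]
  have sη : ∀ k, tsupport (η k) ⊆ tsupport φ := fun k =>
    closure_minimal (fun x hx => by by_contra h; exact hx (η0 k x h)) (isClosed_tsupport φ)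
  have kη : ∀ i, HasCompactSupport (η i) := fun i =>
    hφc.of_isClosed_subset (isClosed_tsupport _) (sη i)
  have dη : ∀ i, Differentiable ℝ (η i) := fun i => (cη i).differentiable one_ne_zero
  have fη : ∀ x i k, fderiv ℝ (η k) x (E i) = Real.exp (u x) *
      (2 * φ x * fderiv ℝ φ x (E i) * p k x + φ x ^ 2 * p i x * p k x + φ x ^ 2 * H x i k) := by
    intro x i k
    have h1 := (((gts_line dφ x (E i)).fun_pow 2).fun_mul (gts_line du x (E i)).exp).fun_mul
      (gts_line (dp k) x (E i))
    have h2 := gts_line (dη k) x (E i)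
    simp only [hη] at h2
    have h3 := h2.unique h1
    simp only [hη]
    rw [h3, hp', ← hH]
    simp
    ring
  have cDT : ∀ i w, Continuous (fun x => fderiv ℝ (T i) x w) := fun i w =>
    ((cT i).continuous_fderiv one_ne_zero).clm_apply continuous_const
  have cDη : ∀ i w, Continuous (fun x => fderiv ℝ (η i) x w) := fun i w =>
    ((cη i).continuous_fderiv one_ne_zero).clm_apply continuous_const
  have kDη : ∀ i w, HasCompactSupport (fun x => fderiv ℝ (η i) x w) := fun i w =>
    (kη i).fderiv_apply ℝ w
  -- the function 1 / v
  obtain ⟨r, hr⟩ : ∃ r : (Fin n → ℝ) → ℝ, r = fun y => 1 / v y := ⟨_, rfl⟩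
  have cr : ContDiff ℝ 1 r := by
    rw [hr]; exact contDiff_const.div cv fun x => (hv0 x).ne'
  have dr : Differentiable ℝ r := cr.differentiable one_ne_zero
  have fr : ∀ x k, fderiv ℝ r x (E k) = - (a x k / v x ^ 3) := by
    intro x k
    have h1 := (hasDerivAt_const (0 : ℝ) (1 : ℝ)).fun_div (gts_line dv x (E k))
      (by simpa using (hv0 x).ne')
    have h2 := gts_line dr x (E k)
    simp only [hr] at h2
    have h3 := h2.unique h1
    simp only [hr]
    rw [h3, fv]
    have := hv0 x
    simp
    field_simp
  have cDr : ∀ w, Continuous (fun x => fderiv ℝ r x w) := fun w =>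
    (cr.continuous_fderiv one_ne_zero).clm_apply continuous_const
  -- integrals
  have I1 : ∀ i k l m, Integrable (fun x => fderiv ℝ (T i) x (E l) * fderiv ℝ (η k) x (E m)) :=
    fun i k l m => ((cDT i _).mul (cDη k _)).integrable_of_hasCompactSupport (kDη k _).mul_left
  have I2 : ∀ k, Integrable (fun x => fderiv ℝ r x (E k) * η k x) :=
    fun k => ((cDr _).mul (cη k).continuous).integrable_of_hasCompactSupport (kη k).mul_left
  have I3 : ∀ k, Integrable (fun x => r x * fderiv ℝ (η k) x (E k)) :=
    fun k => (cr.continuous.mul (cDη k _)).integrable_of_hasCompactSupport (kDη k _).mul_left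
  have I4 : ∀ k, Integrable (fun x => r x * η k x) :=
    fun k => (cr.continuous.mul (cη k).continuous).integrable_of_hasCompactSupport (kη k).mul_left
  have K1 : ∫ x, ∑ i, ∑ k, fderiv ℝ (T i) x (E k) * fderiv ℝ (η k) x (E i)
      = ∫ x, ∑ i, ∑ k, fderiv ℝ (T i) x (E i) * fderiv ℝ (η k) x (E k) := by
    rw [integral_finsetSum _ fun i _ => integrable_finsetSum _ fun k _ => I1 i k k i,
      integral_finsetSum _ fun i _ => integrable_finsetSum _ fun k _ => I1 i k i k]
    refine Finset.sum_congr rfl fun i _ => ?_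
    rw [integral_finsetSum _ fun k _ => I1 i k k i, integral_finsetSum _ fun k _ => I1 i k i k]
    exact Finset.sum_congr rfl fun k _ => gts_swap _ _ (cT i) (cη k) (kT i) (kη k) _ _
  have K2 : ∫ x, ∑ i, ∑ k, fderiv ℝ (T i) x (E i) * fderiv ℝ (η k) x (E k)
      = ∫ x, ∑ k, r x * fderiv ℝ (η k) x (E k) := by
    congr 1
    ext x
    rw [← Finset.sum_mul_sum, ← Finset.mul_sum]
    by_cases hx : x ∈ tsupport φ
    · rw [heq x hx, hr]
    · have : ∀ k, fderiv ℝ (η k) x (E k) = 0 := by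
        intro k
        rw [fderiv_of_notMem_tsupport ℝ (fun h => hx (sη k h))]; rfl
      simp [this]
  have K3 : ∫ x, ∑ k, r x * fderiv ℝ (η k) x (E k) = - ∫ x, ∑ k, fderiv ℝ r x (E k) * η k x := by
    rw [integral_finsetSum _ fun k _ => I3 k, integral_finsetSum _ fun k _ => I2 k,
      ← Finset.sum_neg_distrib]
    exact Finset.sum_congr rfl fun k _ => integral_mul_fderiv_eq_neg_fderiv_mul_of_integrable
      (I2 k) (I3 k) (I4 k) (fun x _ => dr x) (fun x _ => dη k x)
  obtain ⟨P, hP⟩ : ∃ P : (Fin n → ℝ) → ℝ, P = fun x => Real.exp (u x) / v x *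
      (∑ i, (v x * fderiv ℝ φ x (E i) + φ x * a x i / v x) ^ 2
          - (∑ i, p i x * (v x * fderiv ℝ φ x (E i) + φ x * a x i / v x)) ^ 2 / v x ^ 2) :=
    ⟨_, rfl⟩
  have P0 : ∀ x, 0 ≤ P x := fun x => by
    rw [hP]
    exact mul_nonneg (div_nonneg (Real.exp_pos _).le (hv0 x).le)
      (gts_nonneg (fun i => p i x) _ _ (hv2 x) (hv0 x))
  have main : ∀ x, ((∑ i, ∑ j, (g x)⁻¹ i j * fderiv ℝ φ x (E i) * fderiv ℝ φ x (E j))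
            - Bsq x * (φ x) ^ 2) * (Real.exp (u x) * v x)
      = P x - ((∑ i, ∑ k, fderiv ℝ (T i) x (E k) * fderiv ℝ (η k) x (E i))
          + ∑ k, fderiv ℝ r x (E k) * η k x) := by
    intro x
    rw [hB, gts_alg (fun i => p i x) (fun i => fderiv ℝ φ x (E i)) (H x) (hs x) (v x) (φ x)
      (Real.exp (u x)) (hv2 x) (hv0 x) (g x) (hg x) (a x) (ha x)]
    simp only [fT, fη, fr, hP]
    simp only [hη, neg_mul, Finset.sum_neg_distrib]
    ring
  simp only [main]
  have IQ : Integrable (fun x => (∑ i, ∑ k, fderiv ℝ (T i) x (E k) * fderiv ℝ (η k) x (E i))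
          + ∑ k, fderiv ℝ r x (E k) * η k x) :=
    (integrable_finsetSum _ fun i _ => integrable_finsetSum _ fun k _ => I1 i k k i).add
      (integrable_finsetSum _ fun k _ => I2 k)
  have ca : ∀ i, Continuous (fun x => a x i) := by
    intro i
    have : (fun x => a x i) = fun x => fderiv ℝ v x (E i) * v x := by
      ext x; rw [fv]; have := hv0 x; field_simp
    rw [this]
    exact ((cv.continuous_fderiv one_ne_zero).clm_apply continuous_const).mul cv.continuous
  have cDφ : ∀ w, Continuous (fun x => fderiv ℝ φ x w) := fun w =>
    (hφ.continuous_fderiv one_ne_zero).clm_apply continuous_const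
  have hvn : ∀ x, v x ≠ 0 := fun x => (hv0 x).ne'
  have IP : Integrable P := by
    apply Continuous.integrable_of_hasCompactSupport
    · rw [hP]
      have c1 := du.continuous
      have c2 := dv.continuous
      have c3 := dφ.continuous
      have c4 : ∀ i, Continuous (p i) := fun i => (dp i).continuous
      have c5 : ∀ i, Continuous (fun x => v x * fderiv ℝ φ x (E i) + φ x * a x i / v x) :=
        fun i => (c2.mul (cDφ _)).add ((c3.mul (ca i)).div c2 hvn)
      refine ((Real.continuous_exp.comp c1).div c2 hvn).mul (Continuous.sub ?_ ?_)
      · exact continuous_finsetSum _ fun i _ => (c5 i).pow 2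
      · exact ((continuous_finsetSum _ fun i _ => (c4 i).mul (c5 i)).pow 2).div (c2.pow 2)
          fun x => pow_ne_zero 2 (hvn x)
    · refine HasCompactSupport.intro hφc fun x hx => ?_
      simp [hP, image_eq_zero_of_notMem_tsupport hx, fderiv_of_notMem_tsupport ℝ hx]
  rw [integral_sub IP IQ, integral_add
    (integrable_finsetSum _ fun i _ => integrable_finsetSum _ fun k _ => I1 i k k i)
    (integrable_finsetSum _ fun k _ => I2 k), K1, K2, K3]
  have hPint : 0 ≤ ∫ x, P x := integral_nonneg fun x => P0 x
  linarith

theorem gts_cutoff {n : ℕ} {K Ω : Set (Fin n → ℝ)} (hΩ : IsOpen Ω) (hK : IsCompact K)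
    (hKΩ : K ⊆ Ω) (u : (Fin n → ℝ) → ℝ) (hu : ContDiffOn ℝ 2 u Ω) :
    ∃ w : (Fin n → ℝ) → ℝ, ContDiff ℝ 2 w ∧ HasCompactSupport w ∧
      ∀ x ∈ K, w =ᶠ[nhds x] u := by
  obtain ⟨L, hL, hKL, hLΩ⟩ := exists_compact_between hK hΩ hKΩ
  obtain ⟨f, h1, h0, -⟩ := exists_contMDiffMap_one_nhds_of_subset_interior
    (n := 2) (modelWithCornersSelf ℝ (Fin n → ℝ)) hK.isClosed hKL
  have hf : ContDiff ℝ 2 (f : (Fin n → ℝ) → ℝ) := f.contMDiff.contDiff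
  have hfL : tsupport (f : (Fin n → ℝ) → ℝ) ⊆ L :=
    closure_minimal (fun x hx => by by_contra h; exact hx (h0 x h)) hL.isClosed
  refine ⟨fun x => f x * u x, ?_, ?_, ?_⟩
  · rw [contDiff_iff_contDiffAt]
    intro x
    by_cases hx : x ∈ Ω
    · exact hf.contDiffAt.mul (hu.contDiffAt (hΩ.mem_nhds hx))
    · have hx' : x ∈ (tsupport (f : (Fin n → ℝ) → ℝ))ᶜ := fun h => hx (hLΩ (hfL h))
      have : (fun x => f x * u x) =ᶠ[nhds x] fun _ => (0 : ℝ) := by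
        filter_upwards [(isClosed_tsupport _).isOpen_compl.mem_nhds hx'] with y hy
        rw [image_eq_zero_of_notMem_tsupport hy, zero_mul]
      exact contDiffAt_const.congr_of_eventuallyEq this
  · exact HasCompactSupport.intro hL fun x hx => by rw [h0 x hx, zero_mul]
  · intro x hx
    filter_upwards [Filter.Eventually.filter_mono (nhds_le_nhdsSet hx) h1] with y hy
    rw [hy, one_mul]



/-- Stability of graphic translating solitons: if `u` is a `C²` solution of the graphic
translator equation on an open `Ω ⊆ ℝⁿ`, then for every smooth compactly supported `φ`
with support in `Ω`, `∫_Ω (∑ g^{ij} ∂ᵢφ ∂ⱼφ − |B|² φ²) eᵘ v dx ≥ 0`, where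
`v = √(1+|∇u|²)`, `g_{ij} = δ_{ij} + ∂ᵢu ∂ⱼu`, and `|B|² = tr((g⁻¹ Hess u)²)/v²`. -/
theorem graphic_translator_stability
    (n : ℕ) (Ω : Set (Fin n → ℝ)) (hΩ : IsOpen Ω)
    (u : (Fin n → ℝ) → ℝ) (hu : ContDiffOn ℝ 2 u Ω)
    (v : (Fin n → ℝ) → ℝ)
    (hv : ∀ x, v x = Real.sqrt (1 + ∑ i, (fderiv ℝ u x (Pi.single i 1)) ^ 2))
    (g : (Fin n → ℝ) → Matrix (Fin n) (Fin n) ℝ)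
    (hg : ∀ x i j, g x i j = (if i = j then (1 : ℝ) else 0)
        + fderiv ℝ u x (Pi.single i 1) * fderiv ℝ u x (Pi.single j 1))
    (H : (Fin n → ℝ) → Matrix (Fin n) (Fin n) ℝ)
    (hH : ∀ x i j, H x i j
        = fderiv ℝ (fun y => fderiv ℝ u y (Pi.single j 1)) x (Pi.single i 1))
    (Bsq : (Fin n → ℝ) → ℝ)
    (hB : ∀ x, Bsq x = Matrix.trace (((g x)⁻¹ * H x) * ((g x)⁻¹ * H x)) / (v x) ^ 2)
    (heq : ∀ x ∈ Ω,
      ∑ i, fderiv ℝ (fun y => fderiv ℝ u y (Pi.single i 1) / v y) x (Pi.single i 1)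
        = 1 / v x)
    (φ : (Fin n → ℝ) → ℝ) (hφ : ContDiff ℝ (⊤ : ℕ∞) φ)
    (hφc : HasCompactSupport φ) (hφΩ : tsupport φ ⊆ Ω) :
    0 ≤ ∫ x in Ω,
        ((∑ i, ∑ j, (g x)⁻¹ i j * fderiv ℝ φ x (Pi.single i 1) * fderiv ℝ φ x (Pi.single j 1))
            - Bsq x * (φ x) ^ 2) * (Real.exp (u x) * v x) := by
  obtain ⟨w, hw, hwc, hwu⟩ := gts_cutoff hΩ hφc hφΩ u hu
  -- first derivatives agree near points of the support
  have e1 : ∀ x ∈ tsupport φ, fderiv ℝ w =ᶠ[nhds x] fderiv ℝ u := fun x hx => (hwu x hx).fderiv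
  obtain ⟨v', hv'⟩ : ∃ v' : (Fin n → ℝ) → ℝ,
      ∀ x, v' x = Real.sqrt (1 + ∑ i, (fderiv ℝ w x (Pi.single i 1)) ^ 2) := ⟨_, fun _ => rfl⟩
  obtain ⟨g', hg'⟩ : ∃ g' : (Fin n → ℝ) → Matrix (Fin n) (Fin n) ℝ,
      ∀ x i j, g' x i j = (if i = j then (1 : ℝ) else 0)
        + fderiv ℝ w x (Pi.single i 1) * fderiv ℝ w x (Pi.single j 1) :=
    ⟨fun x => Matrix.of fun i j => _, fun _ _ _ => rfl⟩
  obtain ⟨H', hH'⟩ : ∃ H' : (Fin n → ℝ) → Matrix (Fin n) (Fin n) ℝ,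
      ∀ x i j, H' x i j
        = fderiv ℝ (fun y => fderiv ℝ w y (Pi.single j 1)) x (Pi.single i 1) :=
    ⟨fun x => Matrix.of fun i j => _, fun _ _ _ => rfl⟩
  have ev : ∀ x ∈ tsupport φ, v' =ᶠ[nhds x] v := by
    intro x hx
    filter_upwards [e1 x hx] with y hy
    rw [hv, hv', hy]
  have eg : ∀ x ∈ tsupport φ, g' x = g x := by
    intro x hx
    ext i j
    rw [hg, hg', (e1 x hx).self_of_nhds]
  have eH : ∀ x ∈ tsupport φ, H' x = H x := by
    intro x hx
    ext i j
    rw [hH, hH']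
    have : (fun y => fderiv ℝ w y (Pi.single j 1))
        =ᶠ[nhds x] (fun y => fderiv ℝ u y (Pi.single j 1)) := by
      filter_upwards [e1 x hx] with y hy
      rw [hy]
    rw [this.fderiv_eq]
  have core := gts_core n w hw hwc v' hv' g' hg' H' hH' _ (fun x => rfl) φ
    (hφ.of_le (by exact_mod_cast le_top)) hφc (by
      intro x hx
      rw [(ev x hx).self_of_nhds, ← heq x (hφΩ hx)]
      refine Finset.sum_congr rfl fun i _ => ?_
      have : (fun y => fderiv ℝ w y (Pi.single i 1) / v' y)
          =ᶠ[nhds x] (fun y => fderiv ℝ u y (Pi.single i 1) / v y) := by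
        filter_upwards [e1 x hx, ev x hx] with y hy hy'
        rw [hy, hy']
      rw [this.fderiv_eq])
  rw [setIntegral_eq_integral_of_forall_compl_eq_zero]
  · refine core.trans_eq ?_
    congr 1
    ext x
    by_cases hx : x ∈ tsupport φ
    · rw [eg x hx, eH x hx, (ev x hx).self_of_nhds, (hwu x hx).self_of_nhds, hB]
    · simp [image_eq_zero_of_notMem_tsupport hx, fderiv_of_notMem_tsupport ℝ hx]
  · intro x hx
    have hx' : x ∉ tsupport φ := fun h => hx (hφΩ h)
    simp [image_eq_zero_of_notMem_tsupport hx', fderiv_of_notMem_tsupport ℝ hx']
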